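/- Let D and d_eq be positive integers with d_eq ≤ D, and let S_ε denote the set of unitary D×D matrices U such that for every row index α one has ∑_{β=1}^{d_eq} |U_{αβ}|² > 1 − ε. Then for all ε, δ ∈ (0,1), if D > max(10³ ε⁻² log(4/δ), 10⁶ ε⁻⁴) and d_eq > (1 − ε/2)·D, then the Haar probability measure of S_ε on the unitary group U(D) is at least 1 − δ. -/

import Mathlib

open MeasureTheory Matrix Filter

noncomputable instance (D : ℕ) : MeasurableSpace (Matrix.unitaryGroup (Fin D) ℂ) :=
  borel _

instance (D : ℕ) : BorelSpace (Matrix.unitaryGroup (Fin D) ℂ) := ⟨rfl⟩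

/-- The unnormalised Gaussian density on `ℂⁿ`. -/
noncomputable def gaussianWeight {n : Type*} [Fintype n] (x : n → ℂ) : ENNReal :=
  ENNReal.ofReal (Real.exp (-∑ i, ‖x i‖ ^ 2))

lemma measurable_gaussianWeight {n : Type*} [Fintype n] :
    Measurable (gaussianWeight (n := n)) := by
  unfold gaussianWeight
  fun_prop

lemma lintegral_exp_neg_sum_mul_sq_norm {n : Type*} [Fintype n] (c : n → ℝ) (hc : ∀ i, 0 < c i) :
    ∫⁻ x : n → ℂ, ENNReal.ofReal (Real.exp (-∑ i, c i * ‖x i‖ ^ 2)) =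
      ENNReal.ofReal (∏ i, (Real.pi / c i)) := by
  have h : ∫ x : n → ℂ, Real.exp (-∑ i, c i * ‖x i‖ ^ 2) = ∏ i, (Real.pi / c i) := by
    have h1 : ∀ x : n → ℂ, Real.exp (-∑ i, c i * ‖x i‖ ^ 2)
        = ∏ i, Real.exp (-c i * ‖x i‖ ^ 2) := fun x ↦ by
      rw [← Real.exp_sum, ← Finset.sum_neg_distrib]
      simp only [neg_mul]
    simp_rw [h1]
    rw [integral_fintype_prod_volume_eq_prod (fun i (z : ℂ) ↦ Real.exp (-c i * ‖z‖ ^ 2))]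
    refine Finset.prod_congr rfl fun i _ ↦ ?_
    rw [GaussianFourier.integral_rexp_neg_mul_sq_norm (hc i)]
    simp [Complex.finrank_real_complex]
  have hpos : 0 < ∏ i, (Real.pi / c i) :=
    Finset.prod_pos fun i _ ↦ div_pos Real.pi_pos (hc i)
  rw [← h, ofReal_integral_eq_lintegral_ofReal]
  · by_contra hn
    rw [integral_undef hn] at h
    exact hpos.ne h
  · exact Eventually.of_forall fun x ↦ (Real.exp_pos _).le

lemma sum_sq_norm_vecMul_unitary {n : Type*} [Fintype n] [DecidableEq n]
    (U : unitaryGroup n ℂ) (x : n → ℂ) :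
    ∑ i, ‖(x ᵥ* (U : Matrix n n ℂ)) i‖ ^ 2 = ∑ i, ‖x i‖ ^ 2 := by
  have key : ∀ y : n → ℂ, ((∑ i, ‖y i‖ ^ 2 : ℝ) : ℂ) = y ⬝ᵥ star y := fun y ↦ by
    simp [dotProduct, Complex.mul_conj, Complex.normSq_eq_norm_sq]
  have hU : (U : Matrix n n ℂ) * (U : Matrix n n ℂ)ᴴ = 1 := mem_unitaryGroup_iff.mp U.2
  rw [← Complex.ofReal_inj, key, key, star_vecMul, ← dotProduct_mulVec, mulVec_mulVec, hU,
    one_mulVec]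

lemma measurePreserving_vecMul_unitary {n : Type*} [Fintype n] [DecidableEq n]
    (U : unitaryGroup n ℂ) :
    MeasurePreserving (fun x : n → ℂ ↦ x ᵥ* (U : Matrix n n ℂ)) := by
  have hdet : LinearMap.det
      ((vecMulLinear (U : Matrix n n ℂ)).restrictScalars ℝ : (n → ℂ) →ₗ[ℝ] (n → ℂ)) = 1 := by
    have h2 : LinearMap.det (vecMulLinear (U : Matrix n n ℂ)) = (U : Matrix n n ℂ).det := by
      rw [← det_transpose, ← LinearMap.det_toLin']
      congr 1
      ext x i
      simp
    have h3 : ‖(U : Matrix n n ℂ).det‖ = 1 :=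
      CStarRing.norm_of_mem_unitary (det_of_mem_unitary U.2)
    rw [LinearMap.det_restrictScalars, h2, Algebra.norm_complex_apply, Complex.normSq_eq_norm_sq,
      h3, one_pow]
  refine ⟨(Continuous.matrix_vecMul continuous_id continuous_const).measurable, ?_⟩
  have := Measure.map_linearMap_addHaar_eq_smul_addHaar (volume : Measure (n → ℂ))
    (f := (vecMulLinear (U : Matrix n n ℂ)).restrictScalars ℝ) (by rw [hdet]; exact one_ne_zero)
  rw [hdet] at this
  simp only [inv_one, abs_one, ENNReal.ofReal_one, one_smul] at this
  exact this

lemma gaussianWeight_preimage_vecMul_unitary {n : Type*} [Fintype n] [DecidableEq n]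
    (U : unitaryGroup n ℂ) {C : Set (n → ℂ)} (hC : MeasurableSet C) :
    (volume.withDensity gaussianWeight) ((fun x ↦ x ᵥ* (U : Matrix n n ℂ)) ⁻¹' C) =
      (volume.withDensity gaussianWeight) C := by
  have hU := measurePreserving_vecMul_unitary U
  rw [withDensity_apply _ hC, withDensity_apply _ (hU.measurable hC),
    ← hU.setLIntegral_comp_preimage hC measurable_gaussianWeight]
  simp only [gaussianWeight, sum_sq_norm_vecMul_unitary]

lemma exists_unitary_row_eq {n : Type*} [Fintype n] [DecidableEq n] (a : n) (x : n → ℂ)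
    (hx : x ≠ 0) : ∃ (r : ℝ) (W : unitaryGroup n ℂ), 0 < r ∧
      x = (r : ℂ) • (W : Matrix n n ℂ) a := by
  set y : EuclideanSpace ℂ n := WithLp.toLp 2 x with hy
  have hy0 : y ≠ 0 := by
    intro h
    apply hx
    ext i
    exact congrArg (fun v : EuclideanSpace ℂ n ↦ v i) h
  have hr : 0 < ‖y‖ := norm_pos_iff.mpr hy0
  have hrc : (‖y‖ : ℂ) ≠ 0 := by exact_mod_cast hr.ne'
  obtain ⟨b, hb⟩ := Orthonormal.exists_orthonormalBasis_extension_of_card_eq (𝕜 := ℂ)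
    (E := EuclideanSpace ℂ n) (ι := n) (by simp) (v := fun _ ↦ (‖y‖ : ℂ)⁻¹ • y) (s := {a}) (by
      rw [orthonormal_iff_ite]
      rintro ⟨i, hi⟩ ⟨j, hj⟩
      simp only [Set.mem_singleton_iff] at hi hj
      subst hi hj
      rw [if_pos rfl, inner_self_eq_norm_sq_to_K]
      change ((‖(‖y‖ : ℂ)⁻¹ • y‖ : ℝ) : ℂ) ^ 2 = 1
      rw [norm_smul, norm_inv, Complex.norm_real,
        norm_norm, inv_mul_cancel₀ hr.ne']
      simp)
  refine ⟨‖y‖, ⟨Matrix.of fun i j ↦ b i j, ?_⟩, hr, ?_⟩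
  · rw [mem_unitaryGroup_iff]
    ext i j
    have := orthonormal_iff_ite.mp b.orthonormal j i
    simp only [PiLp.inner_apply, RCLike.inner_apply] at this
    simp only [star_eq_conjTranspose, mul_apply, conjTranspose_apply, of_apply, one_apply,
      RCLike.star_def]
    rw [this]
    simp only [eq_comm]
  · ext j
    have : (b a) j = (‖y‖ : ℂ)⁻¹ * x j := by rw [hb a rfl]; rfl
    simp [this, hrc]

/-- A row of a Haar-distributed unitary lies in a cone with the same probability as a standard
complex Gaussian vector does. -/
lemma haar_row_mem_cone {D : ℕ} (μ : Measure (unitaryGroup (Fin D) ℂ))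
    [μ.IsMulLeftInvariant] [IsProbabilityMeasure μ] (a : Fin D) {C : Set (Fin D → ℂ)}
    (hC : MeasurableSet C) (hcone : ∀ (r : ℝ) x, 0 < r → ((r : ℂ) • x ∈ C ↔ x ∈ C)) :
    μ {U | (U : Matrix (Fin D) (Fin D) ℂ) a ∈ C} *
        (volume.withDensity gaussianWeight) (Set.univ : Set (Fin D → ℂ)) =
      (volume.withDensity gaussianWeight) C := by
  have : Nonempty (Fin D) := ⟨a⟩
  set ν : Measure (Fin D → ℂ) := volume.withDensity gaussianWeight with hν
  have : SFinite ν := by rw [hν]; infer_instance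
  have hval : Continuous fun p : unitaryGroup (Fin D) ℂ × (Fin D → ℂ) ↦
      p.2 ᵥ* (p.1 : Matrix (Fin D) (Fin D) ℂ) :=
    Continuous.matrix_vecMul continuous_snd (continuous_subtype_val.comp continuous_fst)
  have hS : MeasurableSet {p : unitaryGroup (Fin D) ℂ × (Fin D → ℂ) |
      p.2 ᵥ* (p.1 : Matrix (Fin D) (Fin D) ℂ) ∈ C} := hval.measurable hC
  have hinner : ∀ x : Fin D → ℂ, x ≠ 0 →
      μ {U | x ᵥ* (U : Matrix (Fin D) (Fin D) ℂ) ∈ C} =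
        μ {U | (U : Matrix (Fin D) (Fin D) ℂ) a ∈ C} := by
    intro x hx
    obtain ⟨r, W, hr, rfl⟩ := exists_unitary_row_eq a x hx
    rw [← measure_preimage_mul μ W {U | (U : Matrix (Fin D) (Fin D) ℂ) a ∈ C}]
    congr 1
    ext U
    simp only [Set.mem_ofPred_eq, Set.mem_preimage, smul_vecMul, hcone r _ hr]
    rfl
  have h0 : ∀ᵐ x ∂ν, x ≠ 0 :=
    (withDensity_absolutelyContinuous _ _).ae_le (Measure.ae_ne volume 0)
  calc _ = ∫⁻ _, μ {U | (U : Matrix (Fin D) (Fin D) ℂ) a ∈ C} ∂ν := by rw [lintegral_const]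
    _ = ∫⁻ x, μ {U | x ᵥ* (U : Matrix (Fin D) (Fin D) ℂ) ∈ C} ∂ν :=
        lintegral_congr_ae (h0.mono fun x hx ↦ (hinner x hx).symm)
    _ = (μ.prod ν) _ := (Measure.prod_apply_symm hS).symm
    _ = ∫⁻ U, ν ((fun x ↦ x ᵥ* (U : Matrix (Fin D) (Fin D) ℂ)) ⁻¹' C) ∂μ :=
        Measure.prod_apply hS
    _ = ∫⁻ _, ν C ∂μ := lintegral_congr fun U ↦ gaussianWeight_preimage_vecMul_unitary U hC
    _ = ν C := by simp

/-- Chernoff bound for the lower tail of the mass that a row of a Haar-distributed unitary puts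
on the coordinates in `s`. -/
lemma haar_row_sum_sq_le {D : ℕ} (μ : Measure (unitaryGroup (Fin D) ℂ))
    [μ.IsMulLeftInvariant] [IsProbabilityMeasure μ] (a : Fin D) (s : Finset (Fin D)) {ε t : ℝ}
    (hε0 : 0 ≤ ε) (ht0 : 0 ≤ t) (ht1 : t * (1 - ε) < 1) :
    μ {U | ∑ i ∈ s, ‖(U : Matrix (Fin D) (Fin D) ℂ) a i‖ ^ 2 ≤ 1 - ε} ≤
      ENNReal.ofReal (((1 + t * ε) ^ s.card)⁻¹ * ((1 - t * (1 - ε)) ^ sᶜ.card)⁻¹) := by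
  set C : Set (Fin D → ℂ) := {x | ∑ i ∈ s, ‖x i‖ ^ 2 ≤ (1 - ε) * ∑ i, ‖x i‖ ^ 2} with hCdef
  have hC : MeasurableSet C := measurableSet_le (by fun_prop) (by fun_prop)
  have hcone : ∀ (r : ℝ) x, 0 < r → ((r : ℂ) • x ∈ C ↔ x ∈ C) := by
    intro r x hr
    simp only [hCdef, Set.mem_ofPred_eq, Pi.smul_apply, norm_smul, mul_pow, ← Finset.mul_sum,
      Complex.norm_real, Real.norm_eq_abs, sq_abs]
    rw [mul_left_comm, mul_le_mul_iff_right₀ (by positivity)]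
  have hrow : ∀ U : unitaryGroup (Fin D) ℂ,
      ∑ i, ‖(U : Matrix (Fin D) (Fin D) ℂ) a i‖ ^ 2 = 1 := by
    intro U
    have := sum_sq_norm_vecMul_unitary U (Pi.single a 1)
    rw [single_one_vecMul] at this
    rw [show (∑ i, ‖(U : Matrix (Fin D) (Fin D) ℂ) a i‖ ^ 2) = _ from this,
      Finset.sum_eq_single a (by simp +contextual) (by simp)]
    simp
  have hset : {U : unitaryGroup (Fin D) ℂ |
      ∑ i ∈ s, ‖(U : Matrix (Fin D) (Fin D) ℂ) a i‖ ^ 2 ≤ 1 - ε} =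
      {U : unitaryGroup (Fin D) ℂ | (U : Matrix (Fin D) (Fin D) ℂ) a ∈ C} := by
    ext U
    simp only [hCdef, Set.mem_ofPred_eq, hrow, mul_one]
  set c : Fin D → ℝ := fun i ↦ if i ∈ s then 1 + t * ε else 1 - t * (1 - ε) with hcdef
  have hp1 : 0 < 1 + t * ε := by positivity
  have hp2 : 0 < 1 - t * (1 - ε) := by linarith
  have hc : ∀ i, 0 < c i := fun i ↦ by simp only [hcdef]; split_ifs <;> assumption
  have hmass : (volume.withDensity gaussianWeight) (Set.univ : Set (Fin D → ℂ)) =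
      ENNReal.ofReal (Real.pi ^ D) := by
    have := lintegral_exp_neg_sum_mul_sq_norm (fun _ : Fin D ↦ (1 : ℝ)) (by simp)
    simp only [one_mul, div_one, Finset.prod_const, Finset.card_univ, Fintype.card_fin] at this
    rw [withDensity_apply _ MeasurableSet.univ, setLIntegral_univ]
    exact this
  have hprod : ∏ i, (Real.pi / c i) =
      ((1 + t * ε) ^ s.card)⁻¹ * ((1 - t * (1 - ε)) ^ sᶜ.card)⁻¹ * Real.pi ^ D := by
    have h1 : ∏ i ∈ s, c i = (1 + t * ε) ^ s.card :=
      Finset.prod_eq_pow_card fun i hi ↦ by simp [hcdef, hi]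
    have h2 : ∏ i ∈ sᶜ, c i = (1 - t * (1 - ε)) ^ sᶜ.card :=
      Finset.prod_eq_pow_card fun i hi ↦ by simp [hcdef, Finset.mem_compl.mp hi]
    rw [Finset.prod_div_distrib, ← Finset.prod_mul_prod_compl s c, h1, h2]
    simp only [Finset.prod_const, Finset.card_univ, Fintype.card_fin]
    field_simp
  have hCle : (volume.withDensity gaussianWeight) C ≤ ENNReal.ofReal (∏ i, (Real.pi / c i)) := by
    rw [withDensity_apply _ hC, ← lintegral_exp_neg_sum_mul_sq_norm c hc]
    refine (setLIntegral_mono' hC fun x hx ↦ ?_).trans (setLIntegral_le_lintegral _ _)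
    refine ENNReal.ofReal_le_ofReal (Real.exp_le_exp.mpr (neg_le_neg ?_))
    have hx' : ∑ i ∈ s, ‖x i‖ ^ 2 ≤ (1 - ε) * ∑ i, ‖x i‖ ^ 2 := hx
    have h1 : ∀ i, c i * ‖x i‖ ^ 2 =
        (1 - t * (1 - ε)) * ‖x i‖ ^ 2 + t * (if i ∈ s then ‖x i‖ ^ 2 else 0) := fun i ↦ by
      simp only [hcdef]
      split_ifs <;> ring
    simp_rw [h1]
    rw [Finset.sum_add_distrib, ← Finset.mul_sum, ← Finset.mul_sum, Finset.sum_ite_mem,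
      Finset.univ_inter]
    nlinarith
  have hpi : 0 < Real.pi ^ D := by positivity
  have hfin := haar_row_mem_cone μ a hC hcone
  rw [hset]
  rw [hmass] at hfin
  rw [hprod, ENNReal.ofReal_mul (by positivity), ← hfin] at hCle
  exact (ENNReal.mul_le_mul_iff_left (by simpa using hpi) ENNReal.ofReal_ne_top).mp hCle

lemma chernoff_factor_le {m k D ε : ℝ} (hε : 0 < ε) (hε1 : ε < 1) (hmk : m + k = D)
    (hm : (1 - ε / 2) * D < m) (hk : 0 ≤ k) :
    Real.exp (-(m * (ε / 5))) * Real.exp (k * ((1 - ε) / 3)) ≤ Real.exp (-(ε * D / 30)) := by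
  rw [← Real.exp_add, Real.exp_le_exp]
  have hD : 0 < D := by nlinarith
  have h1 : k * ((1 - ε) / 3) ≤ ε / 2 * D * ((1 - ε) / 3) := by
    gcongr
    linarith
  have h2 : (1 - ε / 2) * D * (ε / 5) ≤ m * (ε / 5) := by gcongr
  nlinarith [mul_pos (mul_pos hε hε) hD]

lemma inv_one_add_pow_le {ε : ℝ} (hε : 0 < ε) (hε1 : ε < 1) (m : ℕ) :
    ((1 + 1 / 4 * ε) ^ m)⁻¹ ≤ Real.exp (-(m * (ε / 5))) := by
  rw [Real.exp_neg, Real.exp_nat_mul]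
  gcongr
  have h : Real.exp (ε / 5) * (1 - ε / 5) ≤ 1 := by
    have := Real.one_sub_le_exp_neg (ε / 5)
    calc _ ≤ Real.exp (ε / 5) * Real.exp (-(ε / 5)) := by gcongr
      _ = 1 := by rw [← Real.exp_add]; simp
  have h2 : 1 ≤ (1 + 1 / 4 * ε) * (1 - ε / 5) := by nlinarith
  exact le_of_mul_le_mul_right (h.trans h2) (by linarith)

lemma inv_one_sub_pow_le {ε : ℝ} (hε : 0 < ε) (hε1 : ε < 1) (k : ℕ) :
    ((1 - 1 / 4 * (1 - ε)) ^ k)⁻¹ ≤ Real.exp (k * ((1 - ε) / 3)) := by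
  rw [Real.exp_nat_mul, ← inv_pow]
  have h0 : 0 < 1 - 1 / 4 * (1 - ε) := by linarith
  gcongr
  refine le_trans ?_ (Real.add_one_le_exp _)
  rw [inv_le_iff_one_le_mul₀ h0]
  nlinarith

lemma mul_exp_neg_le {D ε δ : ℝ} (hε : 0 < ε) (hε1 : ε < 1) (hδ : 0 < δ)
    (hD1 : 10 ^ 3 * ε⁻¹ ^ 2 * Real.log (4 / δ) < D) (hD2 : 10 ^ 6 * ε⁻¹ ^ 4 < D) :
    D * Real.exp (-(ε * D / 30)) ≤ δ := by
  have hD0 : 0 < D := lt_trans (by positivity) hD2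
  have h1 : Real.log (4 / δ) ≤ ε * D / 60 := by
    have h : 10 ^ 3 * Real.log (4 / δ) < D * ε ^ 2 := by
      have := mul_lt_mul_of_pos_right hD1 (pow_pos hε 2)
      field_simp at this ⊢
      linarith
    nlinarith [mul_pos hε hD0]
  have h2 : 10 ^ 6 < D * ε ^ 2 := by
    have h : 10 ^ 6 < D * ε ^ 4 := by
      have := mul_lt_mul_of_pos_right hD2 (pow_pos hε 4)
      field_simp at this ⊢
      linarith
    have : D * ε ^ 4 ≤ D * ε ^ 2 := by
      have := pow_le_pow_of_le_one hε.le hε1.le (show 2 ≤ 4 by norm_num)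
      gcongr
    linarith
  have h3 : 4 / δ ≤ Real.exp (ε * D / 60) := by
    rwa [← Real.log_le_iff_le_exp (by positivity)]
  have h4 : D ≤ 4 * Real.exp (ε * D / 60) := by
    have := Real.quadratic_le_exp_of_nonneg (show 0 ≤ ε * D / 60 by positivity)
    nlinarith [mul_pos hε hD0, mul_lt_mul_of_pos_right h2 hD0]
  have h5 : Real.exp (ε * D / 30) = Real.exp (ε * D / 60) * Real.exp (ε * D / 60) := by
    rw [← Real.exp_add]; ring_nf
  rw [Real.exp_neg, ← div_eq_mul_inv, div_le_iff₀ (Real.exp_pos _), h5]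
  rw [div_le_iff₀ hδ] at h3
  nlinarith [Real.exp_pos (ε * D / 60)]

/-- For all `ε, δ ∈ (0,1)`, if `D > max(10³ ε⁻² log(4/δ), 10⁶ ε⁻⁴)` and
`d_eq > (1 − ε/2)·D`, then the Haar probability measure of
`S_ε = {U ∈ U(D) : ∀ α, ∑_{β=1}^{d_eq} |U_{αβ}|² > 1 − ε}` is at least `1 − δ`. -/
theorem stmt0 (D deq : ℕ) (hD : 0 < D) (hdeq : 0 < deq) (hle : deq ≤ D)
    (μ : Measure (Matrix.unitaryGroup (Fin D) ℂ))
    [μ.IsHaarMeasure] [IsProbabilityMeasure μ]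
    (ε δ : ℝ) (hε : ε ∈ Set.Ioo (0:ℝ) 1) (hδ : δ ∈ Set.Ioo (0:ℝ) 1)
    (hDbig : (D : ℝ) > max (10^3 * ε⁻¹^2 * Real.log (4/δ)) (10^6 * ε⁻¹^4))
    (hdeqbig : (deq : ℝ) > (1 - ε/2) * D) :
    μ {U : Matrix.unitaryGroup (Fin D) ℂ |
        ∀ α : Fin D, (1 - ε) <
          ∑ β ∈ Finset.univ.filter (fun β : Fin D => (β : ℕ) < deq),
            ‖(U : Matrix (Fin D) (Fin D) ℂ) α β‖^2 } ≥ ENNReal.ofReal (1 - δ) := by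
  obtain ⟨hε0, hε1⟩ := hε
  set s : Finset (Fin D) := Finset.univ.filter (fun β : Fin D => (β : ℕ) < deq) with hs
  have hcard : s.card = deq := by
    rw [hs, Fin.card_filter_val_lt, min_eq_right hle]
  have hadd : (s.card : ℝ) + (sᶜ.card : ℝ) = D := by
    have := Finset.card_add_card_compl s
    rw [Fintype.card_fin] at this
    exact_mod_cast this
  set G := {U : Matrix.unitaryGroup (Fin D) ℂ |
    ∀ α : Fin D, (1 - ε) < ∑ β ∈ s, ‖(U : Matrix (Fin D) (Fin D) ℂ) α β‖^2} with hG
  have hcompl : Gᶜ =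
      ⋃ α : Fin D, {U : unitaryGroup (Fin D) ℂ |
        ∑ i ∈ s, ‖(U : Matrix (Fin D) (Fin D) ℂ) α i‖ ^ 2 ≤ 1 - ε} := by
    ext U
    simp [hG]
  have hrow : ∀ α : Fin D,
      μ {U | ∑ i ∈ s, ‖(U : Matrix (Fin D) (Fin D) ℂ) α i‖ ^ 2 ≤ 1 - ε} ≤
        ENNReal.ofReal (Real.exp (-(ε * D / 30))) := fun α ↦
    (haar_row_sum_sq_le μ α s (t := 1 / 4) hε0.le (by norm_num) (by linarith)).trans <|
      ENNReal.ofReal_le_ofReal <|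
        (mul_le_mul (inv_one_add_pow_le hε0 hε1 _) (inv_one_sub_pow_le hε0 hε1 _)
          (inv_nonneg.mpr (pow_nonneg (by linarith) _)) (Real.exp_pos _).le).trans
        (chernoff_factor_le hε0 hε1 hadd (by rw [hcard]; exact hdeqbig) (Nat.cast_nonneg _))
  have hbad : μ Gᶜ ≤ ENNReal.ofReal δ := by
    rw [hcompl]
    refine (measure_iUnion_fintype_le μ _).trans ((Finset.sum_le_sum fun α _ ↦ hrow α).trans ?_)
    rw [Finset.sum_const, Finset.card_univ, Fintype.card_fin, nsmul_eq_mul,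
      ← ENNReal.ofReal_natCast, ← ENNReal.ofReal_mul (Nat.cast_nonneg _)]
    exact ENNReal.ofReal_le_ofReal (mul_exp_neg_le hε0 hε1 hδ.1
      (lt_of_le_of_lt (le_max_left _ _) hDbig) (lt_of_le_of_lt (le_max_right _ _) hDbig))
  have hone : 1 ≤ μ G + μ Gᶜ := by
    rw [← measure_univ (μ := μ), ← Set.union_compl_self G]
    exact measure_union_le _ _
  rw [ge_iff_le, ENNReal.ofReal_sub _ hδ.1.le, ENNReal.ofReal_one, tsub_le_iff_right]
  exact hone.trans (by gcongr)
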